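/- arXiv:2603.12161 — 6 statements merged into one kernel-verified Lean document; each statement's English description precedes it below -/
import Mathlib

section
/- Let φ : ℝ × ℝ → ℝ be a smooth (C^∞) function satisfying the KdV equation ∂φ/∂t + ∂³φ/∂x³ - 6φ·∂φ/∂x = 0 at every point. Assume that for every t: (i) φ(·,t), ∂φ/∂x(·,t) and ∂²φ/∂x²(·,t) tend to 0 as x → ±∞; (ii) φ(·,t)² is integrable over ℝ and the function E(t) := ∫_ℝ φ(x,t)² dx is differentiable with E'(t) = 2∫_ℝ φ(x,t)·∂φ/∂t(x,t) dx (differentiation under the integral sign); (iii) the functions x ↦ φ·∂³φ/∂x³, x ↦ ∂φ/∂x·∂²φ/∂x², and x ↦ φ²·∂φ/∂x are integrable over ℝ at time t. Then E'(t) = 0 for all t; i.e., the L² norm ‖φ(·,t)‖_{L²} is conserved in time. -/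
open MeasureTheory Filter

/-- Conservation of the L² norm for smooth, decaying solutions of the KdV equation:
if φ solves ∂φ/∂t + ∂³φ/∂x³ - 6φ·∂φ/∂x = 0, φ and its first two spatial derivatives
vanish at spatial infinity, φ(·,t)² is integrable, E(t) = ∫ φ² satisfies
E'(t) = 2∫ φ·∂φ/∂t (differentiation under the integral sign), and the relevant
products are integrable, then E'(t) = 0 for all t. -/
theorem kdv_norm_conservation
    (φ : ℝ → ℝ → ℝ)
    (hsmooth : ContDiff ℝ (⊤ : ℕ∞) (fun p : ℝ × ℝ => φ p.1 p.2))
    (hkdv : ∀ x t : ℝ,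
      deriv (fun s => φ x s) t + iteratedDeriv 3 (fun y => φ y t) x
        - 6 * φ x t * deriv (fun y => φ y t) x = 0)
    (hdecay₀ : ∀ t : ℝ, Tendsto (fun x => φ x t) atTop (nhds 0) ∧
        Tendsto (fun x => φ x t) atBot (nhds 0))
    (hdecay₁ : ∀ t : ℝ, Tendsto (fun x => deriv (fun y => φ y t) x) atTop (nhds 0) ∧
        Tendsto (fun x => deriv (fun y => φ y t) x) atBot (nhds 0))
    (hdecay₂ : ∀ t : ℝ, Tendsto (fun x => iteratedDeriv 2 (fun y => φ y t) x) atTop (nhds 0) ∧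
        Tendsto (fun x => iteratedDeriv 2 (fun y => φ y t) x) atBot (nhds 0))
    (hint : ∀ t : ℝ, Integrable (fun x => (φ x t) ^ 2))
    (E : ℝ → ℝ) (hE : ∀ t : ℝ, E t = ∫ x : ℝ, (φ x t) ^ 2)
    (hE' : ∀ t : ℝ,
      HasDerivAt E (2 * ∫ x : ℝ, φ x t * deriv (fun s => φ x s) t) t)
    (hint₃ : ∀ t : ℝ,
      Integrable (fun x => φ x t * iteratedDeriv 3 (fun y => φ y t) x) ∧
      Integrable (fun x => deriv (fun y => φ y t) x * iteratedDeriv 2 (fun y => φ y t) x) ∧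
      Integrable (fun x => (φ x t) ^ 2 * deriv (fun y => φ y t) x)) :
    ∀ t : ℝ, deriv E t = 0 := by
  intro t
  rw [(hE' t).deriv]
  have hf : ContDiff ℝ (⊤ : ℕ∞) (fun y => φ y t) :=
    hsmooth.comp (contDiff_id.prodMk contDiff_const)
  have h0 : ∀ x, HasDerivAt (fun y => φ y t) (deriv (fun y => φ y t) x) x := fun x =>
    ((hf.differentiable (by simp)) x).hasDerivAt
  have hstep : ∀ (n : ℕ) (x : ℝ), HasDerivAt (iteratedDeriv n (fun y => φ y t))
      (iteratedDeriv (n + 1) (fun y => φ y t) x) x := by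
    intro n x
    rw [iteratedDeriv_succ]
    exact ((hf.differentiable_iteratedDeriv n (by exact_mod_cast WithTop.coe_lt_top n)) x).hasDerivAt
  have h1 : ∀ x, HasDerivAt (deriv (fun y => φ y t)) (iteratedDeriv 2 (fun y => φ y t) x) x := by
    intro x
    have := hstep 1 x
    rwa [iteratedDeriv_one] at this
  have h2 := hstep 2
  obtain ⟨i1, -, i3⟩ := hint₃ t
  have heq : (fun x => φ x t * deriv (fun s => φ x s) t) =
      fun x => 6 * ((φ x t) ^ 2 * deriv (fun y => φ y t) x)
        - φ x t * iteratedDeriv 3 (fun y => φ y t) x := by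
    funext x
    linear_combination φ x t * hkdv x t
  have hlim : ∀ l : Filter ℝ, Tendsto (fun x => φ x t) l (nhds 0) →
      Tendsto (fun x => deriv (fun y => φ y t) x) l (nhds 0) →
      Tendsto (fun x => iteratedDeriv 2 (fun y => φ y t) x) l (nhds 0) →
      Tendsto (fun x => 2 * (φ x t) ^ 3 - φ x t * iteratedDeriv 2 (fun y => φ y t) x
        + (1 / 2) * (deriv (fun y => φ y t) x) ^ 2) l (nhds 0) := by
    intro l a b c
    have := (((a.pow 3).const_mul 2).sub (a.mul c)).add ((b.pow 2).const_mul (1 / 2))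
    simpa using this
  have key := integral_of_hasDerivAt_of_tendsto
    (f := fun x => 2 * (φ x t) ^ 3 - φ x t * iteratedDeriv 2 (fun y => φ y t) x
        + (1 / 2) * (deriv (fun y => φ y t) x) ^ 2)
    (f' := fun x => 6 * ((φ x t) ^ 2 * deriv (fun y => φ y t) x)
        - φ x t * iteratedDeriv 3 (fun y => φ y t) x)
    (fun x => by
      have := ((((h0 x).pow 3).const_mul 2).sub ((h0 x).mul (h2 x))).add
        (((h1 x).pow 2).const_mul (1 / 2))
      refine this.congr_deriv ?_
      norm_num
      ring)
    ((i3.const_mul 6).sub i1)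
    (hlim _ (hdecay₀ t).2 (hdecay₁ t).2 (hdecay₂ t).2)
    (hlim _ (hdecay₀ t).1 (hdecay₁ t).1 (hdecay₂ t).1)
  rw [heq, key]
  simp
end

section
/- For δ ∈ (0,1) define φ_δ, φ'_δ : ℝ → ℝ by φ_δ(x) = -(1/2)·sech²(x/2) and φ'_δ(x) = -((1+δ)/2)·sech²((√(1+δ)/2)·x). Then there exist constants C > 0 and δ₀ ∈ (0,1) such that for all δ ∈ (0,δ₀), ∫_ℝ (φ_δ(x) - φ'_δ(x))² dx ≤ C·δ². Equivalently, the L² distance between the two soliton profiles at time t = 0 is O(δ). -/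
open MeasureTheory

lemma kdv_aux (δ s t : ℝ) (h0 : 0 < δ) (hs1 : 1 ≤ s) (hs2 : s ≤ 2) (hs3 : s - 1 ≤ δ / 2)
    (ht : 0 ≤ t) :
    ((-(1 / 2) * (1 / Real.cosh t) ^ 2) - (-((s ^ 2) / 2) * (1 / Real.cosh (s * t)) ^ 2)) ^ 2
      ≤ 4 * δ ^ 2 * (1 + t ^ 2)⁻¹ := by
  have hst : t ≤ s * t := by nlinarith
  have hP := Real.cosh_pos t
  have hQ := Real.cosh_pos (s * t)
  have hPQ : Real.cosh t ≤ Real.cosh (s * t) := by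
    rw [Real.cosh_le_cosh, abs_of_nonneg ht, abs_of_nonneg (by linarith)]
    exact hst
  have hdiff : Real.cosh (s * t) - Real.cosh t ≤ (s - 1) * t * Real.cosh (s * t) := by
    have e1 : Real.exp (s * t) - Real.exp t ≤ (s * t - t) * Real.exp (s * t) := by
      have h1 := Real.add_one_le_exp (t - s * t)
      have h2 : Real.exp t = Real.exp (t - s * t) * Real.exp (s * t) := by
        rw [← Real.exp_add]; congr 1; ring
      have h3 := Real.exp_pos (s * t)
      rw [h2]; nlinarith
    have e2 : Real.exp (-(s * t)) ≤ Real.exp (-t) := Real.exp_le_exp.mpr (by linarith)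
    have e3 : 0 ≤ (s * t - t) * Real.exp (-(s * t)) :=
      mul_nonneg (by linarith) (Real.exp_pos _).le
    rw [Real.cosh_eq, Real.cosh_eq]
    nlinarith
  have hlin : 1 + t ≤ 2 * Real.cosh t := by
    have h1 := Real.add_one_le_exp t
    have h2 := Real.exp_pos (-t)
    rw [Real.cosh_eq]; linarith
  have hsq : 1 + t ^ 2 ≤ Real.cosh t ^ 2 := by
    have h1 : t ≤ Real.sinh t := Real.self_le_sinh_iff.mpr ht
    rw [Real.cosh_sq]; nlinarith
  generalize Real.cosh t = P at *
  generalize Real.cosh (s * t) = Q at *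
  have hp2 : (1 / P) ^ 2 ≤ (1 + t ^ 2)⁻¹ := by
    rw [one_div, inv_pow]
    exact inv_anti₀ (by positivity) hsq
  have hqp : 1 / Q ≤ 1 / P := one_div_le_one_div_of_le hP hPQ
  have hd : 1 / P - 1 / Q ≤ (s - 1) * t * (1 / P) := by
    have : 1 / P - 1 / Q = (Q - P) * (1 / (P * Q)) := by field_simp
    rw [this]
    have h2 : (s - 1) * t * (1 / P) = ((s - 1) * t * Q) * (1 / (P * Q)) := by field_simp
    rw [h2]
    exact mul_le_mul_of_nonneg_right hdiff (by positivity)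
  have hl : (1 + t) * (1 / P) ≤ 2 := by
    rw [mul_one_div, div_le_iff₀ hP]; exact hlin
  have hp : 0 < 1 / P := by positivity
  have hq : 0 < 1 / Q := by positivity
  generalize 1 / P = p at *
  generalize 1 / Q = q at *
  have hm : (s - 1) * ((1 + t) * p) ≤ δ := by nlinarith
  have htp : 0 ≤ (s - 1) * (t * p) := mul_nonneg (by linarith) (by positivity)
  have hsq' : (s - 1) * q ≤ (s - 1) * p := mul_le_mul_of_nonneg_left hqp (by linarith)
  have hsq0 : 0 ≤ (s - 1) * q := mul_nonneg (by linarith) hq.le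
  have ha : (s * q - p) ^ 2 ≤ δ ^ 2 := by
    apply sq_le_sq' <;> nlinarith
  have hb : (s * q + p) ^ 2 ≤ 16 * p ^ 2 := by
    have : s * q + p ≤ 4 * p := by nlinarith
    have h0 : 0 ≤ s * q + p := by positivity
    nlinarith
  calc (-(1 / 2) * p ^ 2 - -(s ^ 2 / 2) * q ^ 2) ^ 2
      = 1 / 4 * ((s * q - p) ^ 2 * (s * q + p) ^ 2) := by ring
    _ ≤ 1 / 4 * (δ ^ 2 * (16 * p ^ 2)) := by gcongr
    _ = 4 * δ ^ 2 * p ^ 2 := by ring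
    _ ≤ _ := by gcongr

/-- The KdV solitons with velocities 1 and 1+δ (offset 0) have squared L² distance
O(δ²) at time t = 0. -/
theorem kdv_soliton_initial_distance :
    ∃ C > (0 : ℝ), ∃ δ₀ ∈ Set.Ioo (0 : ℝ) 1, ∀ δ ∈ Set.Ioo (0 : ℝ) δ₀,
      (∫ x : ℝ,
        ((-(1 / 2) * (1 / Real.cosh (x / 2)) ^ 2)
          - (-((1 + δ) / 2) * (1 / Real.cosh (Real.sqrt (1 + δ) / 2 * x)) ^ 2)) ^ 2)
        ≤ C * δ ^ 2 := by
  refine ⟨16 * Real.pi, by positivity, 1 / 2, by norm_num, ?_⟩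
  rintro δ ⟨h0, h1⟩
  have hss : Real.sqrt (1 + δ) ^ 2 = 1 + δ := Real.sq_sqrt (by linarith)
  have hs0 := Real.sqrt_nonneg (1 + δ)
  generalize Real.sqrt (1 + δ) = s at *
  have hs1 : 1 ≤ s := by nlinarith
  have hs2 : s ≤ 2 := by nlinarith
  have hs3 : s - 1 ≤ δ / 2 := by nlinarith
  have key : ∀ x : ℝ, ((-(1 / 2) * (1 / Real.cosh (x / 2)) ^ 2)
          - (-((1 + δ) / 2) * (1 / Real.cosh (s / 2 * x)) ^ 2)) ^ 2
          ≤ 16 * δ ^ 2 * (1 + x ^ 2)⁻¹ := by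
    intro x
    have h := kdv_aux δ s |x / 2| h0 hs1 hs2 hs3 (abs_nonneg _)
    have e : Real.cosh (s * |x / 2|) = Real.cosh (s / 2 * x) := by
      rw [← Real.cosh_abs (s / 2 * x), show s / 2 * x = s * (x / 2) by ring, abs_mul,
        abs_of_nonneg hs0]
    rw [Real.cosh_abs, e, sq_abs, hss] at h
    refine h.trans ?_
    have h4 : (1 + (x / 2) ^ 2)⁻¹ ≤ 4 * (1 + x ^ 2)⁻¹ := by
      rw [← div_eq_mul_inv, inv_le_comm₀ (by positivity) (by positivity), inv_div]
      nlinarith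
    nlinarith [mul_le_mul_of_nonneg_left h4 (by positivity : 0 ≤ 4 * δ ^ 2)]
  calc _ ≤ ∫ x : ℝ, 16 * δ ^ 2 * (1 + x ^ 2)⁻¹ :=
        integral_mono_of_nonneg (Filter.Eventually.of_forall fun x => sq_nonneg _)
          (integrable_inv_one_add_sq.const_mul _) (Filter.Eventually.of_forall key)
    _ = _ := by
        rw [integral_const_mul, integral_univ_inv_one_add_sq]; ring
end

section
/- For δ > 0 define the unit-normalized shifted soliton profiles ψ_δ, ψ'_δ : ℝ → ℝ by ψ_δ(x) = -√(3/8)·sech²((x+1)/2) and ψ'_δ(x) = -(1+δ)^{1/4}·√(3/8)·sech²((√(1+δ)/2)·(x-1)). Then there exist constants c > 0 and δ₀ > 0 such that for all δ ∈ (0,δ₀): |∫_ℝ ψ_δ(x)·ψ'_δ(x) dx| ≤ 1 - c. Consequently the L² distance between the normalized profiles, which equals √(2 - 2·|∫ ψ_δ ψ'_δ|) after optimizing phase/sign, is bounded below by a positive constant independent of δ. -/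
open MeasureTheory

lemma kdv_aux_deriv (x : ℝ) :
    HasDerivAt (fun x : ℝ => 2 * (Real.sinh (x / 2) / Real.cosh (x / 2)))
      ((1 / Real.cosh (x / 2)) ^ 2) x := by
  have h1 : HasDerivAt (fun x : ℝ => x / 2) (1 / 2) x := (hasDerivAt_id x).div_const 2
  have hc := (Real.cosh_pos (x / 2)).ne'
  have h := ((h1.sinh).div (h1.cosh) hc).const_mul 2
  refine h.congr_deriv ?_
  have := Real.cosh_sq_sub_sinh_sq (x / 2)
  field_simp
  linarith

lemma kdv_aux_cont : Continuous (fun x : ℝ => (1 / Real.cosh (x / 2)) ^ 2) := by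
  have : ∀ x : ℝ, Real.cosh (x / 2) ≠ 0 := fun x => (Real.cosh_pos _).ne'
  have h2 : Continuous (fun x : ℝ => Real.cosh (x / 2)) :=
    Real.continuous_cosh.comp (continuous_id.div_const 2)
  exact (continuous_const.div h2 this).pow 2

lemma kdv_aux_interval (a b : ℝ) :
    ∫ x in a..b, (1 / Real.cosh (x / 2)) ^ 2 ≤ 4 := by
  rw [intervalIntegral.integral_eq_sub_of_hasDerivAt (fun x _ => kdv_aux_deriv x)
    (kdv_aux_cont.intervalIntegrable _ _)]
  have h1 := abs_lt.1 (Real.abs_tanh_lt_one (a / 2))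
  have h2 := abs_lt.1 (Real.abs_tanh_lt_one (b / 2))
  rw [Real.tanh_eq_sinh_div_cosh] at h1 h2
  linarith [h1.1, h2.2]

lemma kdv_aux_integrable : Integrable (fun x : ℝ => (1 / Real.cosh (x / 2)) ^ 2) := by
  refine integrable_of_intervalIntegral_norm_bounded (l := Filter.atTop)
    (a := fun n : ℕ => -(n : ℝ)) (b := fun n : ℕ => (n : ℝ)) 4
    (fun i => (kdv_aux_cont.integrableOn_Icc).mono_set Set.Ioc_subset_Icc_self)
    (Filter.tendsto_neg_atTop_atBot.comp tendsto_natCast_atTop_atTop)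
    tendsto_natCast_atTop_atTop (Filter.Eventually.of_forall fun n => ?_)
  have : ∀ x : ℝ, ‖(1 / Real.cosh (x / 2)) ^ 2‖ = (1 / Real.cosh (x / 2)) ^ 2 :=
    fun x => Real.norm_of_nonneg (sq_nonneg _)
  simp_rw [this]
  exact kdv_aux_interval _ _

lemma kdv_aux_integral : ∫ x : ℝ, (1 / Real.cosh (x / 2)) ^ 2 ≤ 4 :=
  le_of_tendsto (intervalIntegral_tendsto_integral (l := Filter.atTop)
    (a := fun n : ℕ => -(n : ℝ)) (b := fun n : ℕ => (n : ℝ)) kdv_aux_integrable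
    (Filter.tendsto_neg_atTop_atBot.comp tendsto_natCast_atTop_atTop)
    tendsto_natCast_atTop_atTop) (Filter.Eventually.of_forall fun n => kdv_aux_interval _ _)

lemma kdv_aux_cosh_one : 3 / 2 ≤ Real.cosh 1 := by
  have h1 := Real.exp_one_gt_d9
  have h2 := Real.exp_one_lt_d9
  rw [Real.cosh_eq, Real.exp_neg]
  have h3 : (2.7182818286 : ℝ)⁻¹ ≤ (Real.exp 1)⁻¹ :=
    inv_anti₀ (Real.exp_pos 1) h2.le
  norm_num at h1 h3 ⊢
  linarith

lemma kdv_aux_pointwise (k : ℝ) (hk : 1 ≤ k) (x : ℝ) :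
    (1 / Real.cosh ((x + 1) / 2)) ^ 2 * (1 / Real.cosh (k / 2 * (x - 1))) ^ 2
      ≤ 0.64 * (1 / Real.cosh (x / 2)) ^ 2 := by
  have hA := Real.cosh_pos ((x + 1) / 2)
  have hB := Real.cosh_pos ((x - 1) / 2)
  have hC := Real.one_le_cosh (x / 2)
  have hle : Real.cosh ((x - 1) / 2) ≤ Real.cosh (k / 2 * (x - 1)) := by
    rw [Real.cosh_le_cosh, show k / 2 * (x - 1) = k * ((x - 1) / 2) by ring, abs_mul,
      abs_of_nonneg (by linarith : (0 : ℝ) ≤ k)]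
    nlinarith [abs_nonneg ((x - 1) / 2)]
  have hprod : Real.cosh (x / 2) ^ 2 + 1 / 4 ≤
      Real.cosh ((x + 1) / 2) * Real.cosh ((x - 1) / 2) := by
    have e1 : (x + 1) / 2 = x / 2 + 1 / 2 := by ring
    have e2 : (x - 1) / 2 = x / 2 - 1 / 2 := by ring
    have h1 : Real.cosh 1 = Real.cosh (1 / 2) ^ 2 + Real.sinh (1 / 2) ^ 2 := by
      rw [← Real.cosh_two_mul]; norm_num
    have h2 := Real.cosh_sq_sub_sinh_sq (1 / 2)
    have h3 := Real.cosh_sq_sub_sinh_sq (x / 2)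
    have h4 := kdv_aux_cosh_one
    rw [e1, e2, Real.cosh_add, Real.cosh_sub]
    have h5 : Real.sinh (x / 2) ^ 2 = Real.cosh (x / 2) ^ 2 - 1 := by linarith
    have h6 : Real.cosh (1 / 2) ^ 2 = Real.sinh (1 / 2) ^ 2 + 1 := by linarith
    have h7 : 1 / 4 ≤ Real.sinh (1 / 2) ^ 2 := by linarith
    calc _ ≤ Real.cosh (x / 2) ^ 2 + Real.sinh (1 / 2) ^ 2 := by linarith
      _ = Real.cosh (x / 2) ^ 2 * Real.cosh (1 / 2) ^ 2
          - Real.sinh (x / 2) ^ 2 * Real.sinh (1 / 2) ^ 2 := by rw [h5, h6]; ring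
      _ ≤ _ := le_of_eq (by ring)
  have hprod' : Real.cosh (x / 2) ^ 2 + 1 / 4 ≤
      Real.cosh ((x + 1) / 2) * Real.cosh (k / 2 * (x - 1)) :=
    hprod.trans (mul_le_mul_of_nonneg_left hle hA.le)
  rw [← mul_pow, one_div_mul_one_div, one_div_pow, one_div_pow]
  generalize Real.cosh ((x + 1) / 2) * Real.cosh (k / 2 * (x - 1)) = P at *
  generalize Real.cosh (x / 2) = C at *
  have hv : 1 ≤ C ^ 2 := by nlinarith
  have hP : (C ^ 2 + 1 / 4) ^ 2 ≤ P ^ 2 := by gcongr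
  have hP0 : 0 < P ^ 2 := lt_of_lt_of_le (by positivity) hP
  rw [mul_one_div, div_le_div_iff₀ hP0 (by linarith)]
  norm_num
  nlinarith

/-- At time t = 2/δ, after recentering and unit normalization, the two KdV soliton
profiles have overlap bounded away from 1: |∫ ψ_δ ψ'_δ| ≤ 1 - c for a constant c > 0
independent of δ, for all sufficiently small δ > 0. -/
theorem kdv_soliton_final_overlap :
    ∃ c > (0 : ℝ), ∃ δ₀ > (0 : ℝ), ∀ δ ∈ Set.Ioo (0 : ℝ) δ₀,
      |∫ x : ℝ,
        (-Real.sqrt (3 / 8) * (1 / Real.cosh ((x + 1) / 2)) ^ 2) *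
          (-(1 + δ) ^ ((1 : ℝ) / 4) * Real.sqrt (3 / 8) *
            (1 / Real.cosh (Real.sqrt (1 + δ) / 2 * (x - 1))) ^ 2)|
        ≤ 1 - c := by
  refine ⟨0.01, by norm_num, 0.01, by norm_num, fun δ hδ => ?_⟩
  obtain ⟨h0, h1⟩ := hδ
  have hk : 1 ≤ Real.sqrt (1 + δ) := Real.one_le_sqrt.2 (by linarith)
  have hr : (1 + δ) ^ ((1 : ℝ) / 4) ≤ 1.01 := by
    calc (1 + δ) ^ ((1 : ℝ) / 4) ≤ (1 + δ) ^ (1 : ℝ) :=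
          Real.rpow_le_rpow_of_exponent_le (by linarith) (by norm_num)
      _ ≤ 1.01 := by rw [Real.rpow_one]; norm_num at h1 ⊢; linarith
  have hr0 : 0 ≤ (1 + δ) ^ ((1 : ℝ) / 4) := Real.rpow_nonneg (by linarith) _
  have hs : Real.sqrt (3 / 8) * Real.sqrt (3 / 8) = 3 / 8 :=
    Real.mul_self_sqrt (by norm_num)
  rw [← Real.norm_eq_abs]
  refine (norm_integral_le_of_norm_le
    (kdv_aux_integrable.const_mul (1.01 * (3 / 8) * 0.64)) (Filter.Eventually.of_forall
      fun x => ?_)).trans ?_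
  · have hp := kdv_aux_pointwise _ hk x
    set A := (1 / Real.cosh ((x + 1) / 2)) ^ 2 with hA
    set B := (1 / Real.cosh (Real.sqrt (1 + δ) / 2 * (x - 1))) ^ 2 with hB
    have hAB : 0 ≤ A * B := by positivity
    have e : (-Real.sqrt (3 / 8) * A) * (-(1 + δ) ^ ((1 : ℝ) / 4) * Real.sqrt (3 / 8) * B)
        = (1 + δ) ^ ((1 : ℝ) / 4) * (3 / 8) * (A * B) := by
      linear_combination ((1 + δ) ^ ((1 : ℝ) / 4) * (A * B)) * hs
    rw [e, Real.norm_of_nonneg (by positivity), mul_assoc (1.01 * (3 / 8) : ℝ)]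
    gcongr
  · rw [integral_const_mul]
    have := kdv_aux_integral
    norm_num at this ⊢
    linarith
end

section
/- Let α, β, γ, b₁, b₂ be positive reals with α·β > 2γ, and set κ := (b₁ + α·b₂/(2β))/(α·β - 2γ). Then for every ε > 0 and every t ≥ 0: (ε²/2)·[ (b₁ + α·b₂/β)·e^{αβt}·∫₀ᵗ e^{(2γ - αβ)s} ds + b₁·e^{-αβt}·∫₀ᵗ e^{(2γ + αβ)s} ds ] ≤ ε²·κ·(e^{αβt} - 1). -/
/-- Quantitative conclusion of the linearization error bound (Theorem
'error_bound_value'): with κ = (b₁ + αb₂/(2β))/(αβ - 2γ), the Duhamel expression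
is bounded by ε²·κ·(e^{αβt} - 1) for all ε > 0 and t ≥ 0. -/
theorem error_bound_value (α β γ b₁ b₂ κ : ℝ)
    (hα : 0 < α) (hβ : 0 < β) (hγ : 0 < γ) (hb₁ : 0 < b₁) (hb₂ : 0 < b₂)
    (hαβ : 2 * γ < α * β)
    (hκ : κ = (b₁ + α * b₂ / (2 * β)) / (α * β - 2 * γ)) :
    ∀ ε : ℝ, 0 < ε → ∀ t : ℝ, 0 ≤ t →
      ε ^ 2 / 2 *
        ((b₁ + α * b₂ / β) * Real.exp (α * β * t) *
            (∫ s in (0:ℝ)..t, Real.exp ((2 * γ - α * β) * s))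
          + b₁ * Real.exp (-(α * β) * t) *
            (∫ s in (0:ℝ)..t, Real.exp ((2 * γ + α * β) * s)))
        ≤ ε ^ 2 * κ * (Real.exp (α * β * t) - 1) := by
  intro ε hε t ht
  have hI : ∀ c : ℝ, c ≠ 0 → (∫ s in (0:ℝ)..t, Real.exp (c * s)) = (Real.exp (c * t) - 1) / c := by
    intro c hc
    rw [intervalIntegral.integral_comp_mul_left (fun x => Real.exp x) hc, integral_exp]
    simp [div_eq_inv_mul]
  have hab : 0 < α * β := mul_pos hα hβ
  rw [hI _ (by linarith), hI _ (by linarith), hκ]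
  have hc : 0 < α * b₂ / β := by positivity
  have hc2 : α * b₂ / (2 * β) = (α * b₂ / β) / 2 := by field_simp
  rw [hc2]
  generalize α * b₂ / β = c at *
  generalize α * β = a at *
  have h1 : Real.exp (a * t) * ((Real.exp ((2 * γ - a) * t) - 1) / (2 * γ - a))
      = (Real.exp (a * t) - Real.exp (2 * γ * t)) / (a - 2 * γ) := by
    have : Real.exp (a * t) * Real.exp ((2 * γ - a) * t) = Real.exp (2 * γ * t) := by
      rw [← Real.exp_add]; ring_nf
    rw [← this, ← neg_sub a (2 * γ), div_neg]
    ring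
  have h2 : Real.exp (-a * t) * ((Real.exp ((2 * γ + a) * t) - 1) / (2 * γ + a))
      = (Real.exp (2 * γ * t) - Real.exp (-a * t)) / (2 * γ + a) := by
    have : Real.exp (-a * t) * Real.exp ((2 * γ + a) * t) = Real.exp (2 * γ * t) := by
      rw [← Real.exp_add]; ring_nf
    rw [← this]
    ring
  rw [mul_assoc (b₁ + c), mul_assoc b₁, h1, h2]
  have hEF : Real.exp (a * t) * Real.exp (-a * t) = 1 := by
    rw [← Real.exp_add]; simp
  have hE : 1 ≤ Real.exp (a * t) := Real.one_le_exp (by positivity)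
  have hG : 1 ≤ Real.exp (2 * γ * t) := Real.one_le_exp (by positivity)
  generalize Real.exp (a * t) = E at *
  generalize Real.exp (2 * γ * t) = G at *
  have hF0 : 0 < Real.exp (-a * t) := Real.exp_pos _
  generalize Real.exp (-a * t) = F at *
  have hd : 0 < a - 2 * γ := by linarith
  have hF : 2 - E ≤ F := by nlinarith [sq_nonneg (E - 1), sq_nonneg (F - 1), sq_nonneg (E + F - 2), sq_nonneg (E - F)]
  have h3 : (G - F) / (2 * γ + a) ≤ (E - 1 + (G - 1)) / (a - 2 * γ) :=
    div_le_div₀ (by linarith) (by linarith) hd (by linarith)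
  have h4 : (E - G) / (a - 2 * γ) ≤ (E - 1) / (a - 2 * γ) := by
    gcongr
  have h5 : (b₁ + c) * ((E - G) / (a - 2 * γ)) + b₁ * ((G - F) / (2 * γ + a))
      ≤ 2 * ((b₁ + c / 2) * ((E - 1) / (a - 2 * γ))) := by
    have e : (E - 1 + (G - 1)) / (a - 2 * γ)
        = 2 * ((E - 1) / (a - 2 * γ)) - (E - G) / (a - 2 * γ) := by ring
    rw [e] at h3
    have := mul_le_mul_of_nonneg_left h3 hb₁.le
    have := mul_le_mul_of_nonneg_left h4 hc.le
    linarith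
  calc _ ≤ ε ^ 2 / 2 * (2 * ((b₁ + c / 2) * ((E - 1) / (a - 2 * γ)))) := by gcongr
    _ = _ := by ring
end

section
/- Let γ_l, γ_u be reals with 0 < γ_l < γ_u. Then there exist constants c > 0 and ε₀ ∈ (0,1) such that for all ε ∈ (0, ε₀), setting t := (1/γ_u)·log(1/ε), one has √((1 - ε²)/(1 + ε²·(e^{2γ_l t} - 1))) ≤ 1 - c·ε^{2(1 - γ_l/γ_u)}. -/
/-- Overlap decay for the linearized Euler instability: with growth-rate bounds
0 < γ_l < γ_u, setting t = (1/γ_u)·log(1/ε), the overlap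
√((1-ε²)/(1+ε²(e^{2γ_l t}-1))) is at most 1 - c·ε^{2(1-γ_l/γ_u)} for some c > 0
and all sufficiently small ε > 0. -/
theorem linear_overlap_decay (γl γu : ℝ) (h0 : 0 < γl) (hlu : γl < γu) :
    ∃ c > (0 : ℝ), ∃ ε₀ ∈ Set.Ioo (0 : ℝ) 1, ∀ ε ∈ Set.Ioo (0 : ℝ) ε₀,
      Real.sqrt ((1 - ε ^ 2) /
          (1 + ε ^ 2 * (Real.exp (2 * γl * ((1 / γu) * Real.log (1 / ε))) - 1)))
        ≤ 1 - c * ε ^ (2 * (1 - γl / γu)) := by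
  have hu : 0 < γu := h0.trans hlu
  refine ⟨1 / 4, by norm_num, 1 / 2, ⟨by norm_num, by norm_num⟩, ?_⟩
  rintro ε ⟨he, he2⟩
  have hr : 0 < 1 - γl / γu := by
    rw [sub_pos, div_lt_one hu]; exact hlu
  have hx0 : 0 < ε ^ (2 * (1 - γl / γu)) := Real.rpow_pos_of_pos he _
  have hx1 : ε ^ (2 * (1 - γl / γu)) ≤ 1 :=
    Real.rpow_le_one he.le (by linarith) (by linarith)
  have key : ε ^ 2 * Real.exp (2 * γl * ((1 / γu) * Real.log (1 / ε)))
      = ε ^ (2 * (1 - γl / γu)) := by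
    rw [← Real.rpow_natCast ε 2, Real.rpow_def_of_pos he, Real.rpow_def_of_pos he,
      ← Real.exp_add]
    congr 1
    rw [one_div ε, Real.log_inv]
    push_cast
    ring
  rw [mul_sub, key]
  generalize ε ^ (2 * (1 - γl / γu)) = x at hx0 hx1
  have ha : 0 < 1 - ε ^ 2 := by nlinarith
  have ha1 : 1 - ε ^ 2 ≤ 1 := by nlinarith
  have hd : 1 + (x - ε ^ 2 * 1) = (1 - ε ^ 2) + x := by ring
  rw [hd]
  generalize 1 - ε ^ 2 = a at ha ha1
  apply Real.sqrt_le_iff.mpr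
  refine ⟨by linarith, ?_⟩
  rw [div_le_iff₀ (by linarith)]
  have h1 : 0 ≤ x * (2 - a - x) := mul_nonneg hx0.le (by linarith)
  have h2 : 0 ≤ x ^ 2 * (a + x) := by positivity
  nlinarith
end

section
/- Let γ_l, γ_u, α, β, κ be positive reals with γ_l < γ_u and α·β > 2γ_u. Set K := (α·β + γ_u)/(2γ_l), so that K > 3/2 and 2γ_l(K-1) > γ_u. For ε > 0 define H(t, ε) := 1 - (ε²/2)·(e^{2γ_l t} - 1) + (3ε⁴/8)·e^{4γ_l t} + 2√2·ε³·κ·e^{(αβ + γ_u)t}, and define t*(ε) := (1/(2γ_l(K-1)))·log(1/(4√2·ε·κ·K)). Then there exist constants c > 0 and ε₀ > 0 such that for all ε ∈ (0, ε₀): t*(ε) ≤ (1/γ_u)·log(1/ε), and H(t*(ε), ε) ≤ 1 - c·ε^{2 - 1/(K-1)}. -/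
/-- Core estimate of the exponential lower bound for the Euler equations: with
K = (αβ + γ_u)/(2γ_l) one has K > 3/2 and 2γ_l(K-1) > γ_u, and there exist c > 0,
ε₀ > 0 such that for all ε ∈ (0, ε₀), the time
t*(ε) = (1/(2γ_l(K-1)))·log(1/(4√2·ε·κ·K)) satisfies t*(ε) ≤ (1/γ_u)·log(1/ε) and
H(t*(ε), ε) ≤ 1 - c·ε^{2 - 1/(K-1)}, where
H(t,ε) = 1 - (ε²/2)(e^{2γ_l t} - 1) + (3ε⁴/8)e^{4γ_l t} + 2√2·ε³·κ·e^{(αβ+γ_u)t}. -/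
theorem nonlinear_overlap_bound (γl γu α β κ K : ℝ)
    (hγl : 0 < γl) (hγu : 0 < γu) (hα : 0 < α) (hβ : 0 < β) (hκ : 0 < κ)
    (hlu : γl < γu) (hαβ : 2 * γu < α * β)
    (hK : K = (α * β + γu) / (2 * γl)) :
    (3 / 2 < K ∧ γu < 2 * γl * (K - 1)) ∧
    ∃ c > (0 : ℝ), ∃ ε₀ > (0 : ℝ), ∀ ε : ℝ, 0 < ε → ε < ε₀ →
      ((1 / (2 * γl * (K - 1))) * Real.log (1 / (4 * Real.sqrt 2 * ε * κ * K))
          ≤ (1 / γu) * Real.log (1 / ε) ∧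
        1 - ε ^ 2 / 2 *
            (Real.exp (2 * γl * ((1 / (2 * γl * (K - 1)))
                * Real.log (1 / (4 * Real.sqrt 2 * ε * κ * K)))) - 1)
          + 3 * ε ^ 4 / 8 *
            Real.exp (4 * γl * ((1 / (2 * γl * (K - 1)))
                * Real.log (1 / (4 * Real.sqrt 2 * ε * κ * K))))
          + 2 * Real.sqrt 2 * ε ^ 3 * κ *
            Real.exp ((α * β + γu) * ((1 / (2 * γl * (K - 1)))
                * Real.log (1 / (4 * Real.sqrt 2 * ε * κ * K))))
          ≤ 1 - c * ε ^ (2 - 1 / (K - 1))) := by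
  have h1 : 3 / 2 < K := by
    rw [hK, lt_div_iff₀ (by positivity)]; linarith
  have hKm : 2 * γl * K = α * β + γu := by rw [hK]; field_simp
  have h2 : γu < 2 * γl * (K - 1) := by linarith
  refine ⟨⟨h1, h2⟩, ?_⟩
  have hK0 : 0 < K := by linarith
  have hK1 : 0 < K - 1 := by linarith
  have hD : 0 < 2 * γl * (K - 1) := by positivity
  obtain ⟨p, hp⟩ : ∃ p, p = 1 / (K - 1) := ⟨_, rfl⟩
  have hp0 : 0 < p := by rw [hp]; positivity
  have hp2 : 0 < 2 - p := by
    rw [hp, sub_pos, div_lt_iff₀ hK1]; linarith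
  obtain ⟨A, hA⟩ : ∃ A, A = 4 * Real.sqrt 2 * κ * K := ⟨_, rfl⟩
  have hA0 : 0 < A := by rw [hA]; positivity
  obtain ⟨B, hB⟩ : ∃ B, B = Real.exp (-p * Real.log A) := ⟨_, rfl⟩
  have hB0 : 0 < B := by rw [hB]; positivity
  have hlog : Filter.Tendsto (fun ε : ℝ => -Real.log ε) (nhdsWithin 0 (Set.Ioi 0)) Filter.atTop :=
    Filter.tendsto_neg_atBot_atTop.comp Real.tendsto_log_nhdsGT_zero
  have e1 := hlog.eventually_ge_atTop (-Real.log A / (2 * γl * (K - 1))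
      / (1 / γu - 1 / (2 * γl * (K - 1))))
  have e2 := hlog.eventually_ge_atTop (12 / p + Real.log A)
  have e3 := hlog.eventually_ge_atTop (9 * B / (2 - p))
  have e4 : ∀ᶠ ε : ℝ in nhdsWithin 0 (Set.Ioi 0), _ := (e1.and (e2.and e3))
  obtain ⟨ε₀, hε₀, hall⟩ := mem_nhdsGT_iff_exists_Ioo_subset.mp e4
  refine ⟨B / 12, by positivity, ε₀, hε₀, ?_⟩
  intro ε hε hεlt
  obtain ⟨f1, f2, f3⟩ := hall ⟨hε, hεlt⟩
  have hM : Real.log (1 / (4 * Real.sqrt 2 * ε * κ * K)) = -Real.log A - Real.log ε := by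
    rw [show 4 * Real.sqrt 2 * ε * κ * K = A * ε by rw [hA]; ring, one_div, Real.log_inv,
      Real.log_mul hA0.ne' hε.ne']
    ring
  have hexpM : Real.exp (-Real.log A - Real.log ε) = 1 / (A * ε) := by
    rw [Real.exp_sub, Real.exp_neg, Real.exp_log hA0, Real.exp_log hε]
    field_simp
  have hE3 : 0 < 1 / γu - 1 / (2 * γl * (K - 1)) := by
    rw [sub_pos]; exact one_div_lt_one_div_of_lt hγu h2
  rw [hM, ← hp]
  constructor
  · rw [div_le_iff₀ hE3] at f1
    rw [one_div ε, Real.log_inv]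
    have : 1 / (2 * γl * (K - 1)) * (-Real.log A - Real.log ε)
      = -Real.log A / (2 * γl * (K - 1)) + 1 / (2 * γl * (K - 1)) * (-Real.log ε) := by ring
    rw [this]
    linarith
  · obtain ⟨M, hMd⟩ : ∃ M, M = -Real.log A - Real.log ε := ⟨_, rfl⟩
    rw [← hMd] at hexpM ⊢
    have g1 : 2 * γl * (1 / (2 * γl * (K - 1)) * M) = p * M := by
      rw [hp]; field_simp
    have g2 : 4 * γl * (1 / (2 * γl * (K - 1)) * M) = p * M + p * M := by
      rw [← g1]; ring
    have g3 : (α * β + γu) * (1 / (2 * γl * (K - 1)) * M) = p * M + M := by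
      rw [← hKm, hp]; field_simp; ring
    rw [g1, g2, g3, Real.exp_add, Real.exp_add, hexpM]
    obtain ⟨E, hE⟩ : ∃ E, E = Real.exp (p * M) := ⟨_, rfl⟩
    have hE12 : 12 ≤ E := by
      have : 12 / p ≤ M := by linarith
      rw [div_le_iff₀ hp0] at this
      have := Real.add_one_le_exp (p * M)
      linarith
    have hY : ε ^ 2 * E = B * ε ^ (2 - p) := by
      rw [Real.rpow_def_of_pos hε, hB, hE, ← Real.exp_add]
      nth_rewrite 1 [← Real.exp_log hε]
      rw [← Real.exp_nat_mul, ← Real.exp_add, hMd]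
      congr 1
      push_cast
      ring
    have hY9 : ε ^ 2 * E ≤ 1 / 9 := by
      rw [hY, Real.rpow_def_of_pos hε]
      rw [div_le_iff₀ hp2] at f3
      have h := Real.add_one_le_exp (-(Real.log ε * (2 - p)))
      have h' : 9 * B ≤ Real.exp (-(Real.log ε * (2 - p))) := by linarith
      have h'' := mul_le_mul_of_nonneg_right h' (Real.exp_pos (Real.log ε * (2 - p))).le
      rw [← Real.exp_add, neg_add_cancel, Real.exp_zero] at h''
      linarith
    rw [← hE]
    have hT : 2 * Real.sqrt 2 * ε ^ 3 * κ * (E * (1 / (A * ε))) = ε ^ 2 * E / (2 * K) := by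
      rw [hA]; field_simp; ring
    rw [hT, show B / 12 * ε ^ (2 - p) = (ε ^ 2 * E) / 12 by rw [hY]; ring]
    have hε2 : 0 < ε ^ 2 := by positivity
    have hYpos : 0 < ε ^ 2 * E := by positivity
    have k1 : ε ^ 2 * E / (2 * K) ≤ ε ^ 2 * E / 3 :=
      div_le_div_of_nonneg_left hYpos.le (by norm_num) (by linarith)
    have k2 : ε ^ 2 * 12 ≤ ε ^ 2 * E := mul_le_mul_of_nonneg_left hE12 hε2.le
    have k3 : (ε ^ 2 * E) * (ε ^ 2 * E) ≤ (ε ^ 2 * E) * (1 / 9) :=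
      mul_le_mul_of_nonneg_left hY9 hYpos.le
    nlinarith [k1, k2, k3]
end
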